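/- arXiv:1601.07287 — 8 statements merged into one kernel-verified Lean document; each statement's English description precedes it below -/
import Mathlib

section
/- Let λ > 1 and set a₀ = √(1 - 1/λ²). Let R : ℝ³ → ℝ³ be the linear map given by the matrix with rows (1, 0, 0), (0, 1/λ, -a₀), (0, a₀, 1/λ). Then the image under R of the dilated grim reaper cylinder { (λx, λy, -λ·log(cos x)) : x ∈ (-π/2, π/2), y ∈ ℝ } equals the set { (λx, y + √(λ²-1)·log(cos x), √(λ²-1)·y - log(cos x)) : x ∈ (-π/2, π/2), y ∈ ℝ }, and this set equals the graph { (x₁, x₂, w(x₁,x₂)) : x₁ ∈ (-λπ/2, λπ/2), x₂ ∈ ℝ } of the function w(x₁,x₂) = -λ²·log(cos(x₁/λ)) + √(λ²-1)·x₂. -/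
open Real Set

/-- The rotation `R` about the x-axis by angle `arccos (1/λ)` maps the dilated
grim reaper cylinder `{ λ (x, y, -log cos x) }` onto the set
`{ (λx, y + √(λ²-1) log cos x, √(λ²-1) y - log cos x) }`, which is the graph
of `w (x₁, x₂) = -λ² log (cos (x₁/λ)) + √(λ²-1) x₂` over `(-λπ/2, λπ/2) × ℝ`. -/
theorem rotated_dilated_grim_reaper (lam : ℝ) (hlam : 1 < lam) :
    let a₀ : ℝ := Real.sqrt (1 - 1 / lam ^ 2)
    let R : ℝ × ℝ × ℝ → ℝ × ℝ × ℝ := fun p =>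
      (p.1, (1 / lam) * p.2.1 - a₀ * p.2.2, a₀ * p.2.1 + (1 / lam) * p.2.2)
    (R '' {p : ℝ × ℝ × ℝ | ∃ x ∈ Ioo (-(π / 2)) (π / 2), ∃ y : ℝ,
        p = (lam * x, lam * y, lam * (-Real.log (Real.cos x)))}
      = {p : ℝ × ℝ × ℝ | ∃ x ∈ Ioo (-(π / 2)) (π / 2), ∃ y : ℝ,
        p = (lam * x, y + Real.sqrt (lam ^ 2 - 1) * Real.log (Real.cos x),
             Real.sqrt (lam ^ 2 - 1) * y - Real.log (Real.cos x))}) ∧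
    ({p : ℝ × ℝ × ℝ | ∃ x ∈ Ioo (-(π / 2)) (π / 2), ∃ y : ℝ,
        p = (lam * x, y + Real.sqrt (lam ^ 2 - 1) * Real.log (Real.cos x),
             Real.sqrt (lam ^ 2 - 1) * y - Real.log (Real.cos x))}
      = {p : ℝ × ℝ × ℝ | ∃ x₁ ∈ Ioo (-(lam * π / 2)) (lam * π / 2), ∃ x₂ : ℝ,
        p = (x₁, x₂,
             -lam ^ 2 * Real.log (Real.cos (x₁ / lam)) + Real.sqrt (lam ^ 2 - 1) * x₂)}) := by
  intro a₀ R
  have hpos : 0 < lam := by linarith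
  have ha : a₀ * lam = √(lam ^ 2 - 1) := by
    have h : lam ^ 2 - 1 = (1 - 1 / lam ^ 2) * lam ^ 2 := by field_simp
    rw [h, Real.sqrt_mul' _ (sq_nonneg lam), Real.sqrt_sq hpos.le]
  have hs : √(lam ^ 2 - 1) ^ 2 = lam ^ 2 - 1 := Real.sq_sqrt (by nlinarith)
  have hR (x y : ℝ) : R (lam * x, lam * y, lam * (-Real.log (Real.cos x))) =
      (lam * x, y + √(lam ^ 2 - 1) * Real.log (Real.cos x),
        √(lam ^ 2 - 1) * y - Real.log (Real.cos x)) := by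
    simp only [R, ← ha, Prod.mk.injEq, true_and]
    constructor <;> field_simp <;> ring
  constructor
  · ext p
    constructor
    · rintro ⟨_, ⟨x, hx, y, rfl⟩, rfl⟩
      exact ⟨x, hx, y, hR x y⟩
    · rintro ⟨x, hx, y, rfl⟩
      exact ⟨_, ⟨x, hx, y, rfl⟩, hR x y⟩
  · ext p
    constructor
    · rintro ⟨x, ⟨hx₁, hx₂⟩, y, rfl⟩
      refine ⟨lam * x, ⟨by nlinarith, by nlinarith⟩,
        y + √(lam ^ 2 - 1) * Real.log (Real.cos x), ?_⟩
      simp only [Prod.mk.injEq, true_and, mul_div_cancel_left₀ x hpos.ne']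
      linear_combination -Real.log (Real.cos x) * hs
    · rintro ⟨x₁, ⟨hx₁, hx₂⟩, x₂, rfl⟩
      refine ⟨x₁ / lam, ⟨?_, ?_⟩, x₂ - √(lam ^ 2 - 1) * Real.log (Real.cos (x₁ / lam)), ?_⟩
      · rw [lt_div_iff₀ hpos]
        linarith
      · rw [div_lt_iff₀ hpos]
        linarith
      · simp only [Prod.mk.injEq, mul_div_cancel₀ x₁ hpos.ne', sub_add_cancel, true_and]
        linear_combination Real.log (Real.cos (x₁ / lam)) * hs
end

section
/- Let λ > 1 and 0 < d < λπ. Then for every x ∈ [-d/(2λ), d/(2λ)] one has -(d/2)·√(λ²-1) ≤ -λ²·log(cos x) - √(λ²-1)·√((d/2)² - (λx)²) ≤ -λ²·log(cos(d/(2λ))), with the lower bound attained at x = 0 and the upper bound attained at x = ±d/(2λ). -/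
open Real Set

/-- Bounds on the height function
`h (x) = -λ² log (cos x) - √(λ²-1) √((d/2)² - (λx)²)` on `[-d/(2λ), d/(2λ)]`:
the global minimum `-(d/2)√(λ²-1)` is attained at `x = 0` and the global
maximum `-λ² log (cos (d/(2λ)))` is attained at `x = ±d/(2λ)`. -/
theorem grim_reaper_height_bounds (lam d : ℝ)
    (hlam : 1 < lam) (hd0 : 0 < d) (hd : d < lam * π) :
    let h : ℝ → ℝ := fun x =>
      -lam ^ 2 * Real.log (Real.cos x)
        - Real.sqrt (lam ^ 2 - 1) * Real.sqrt ((d / 2) ^ 2 - (lam * x) ^ 2)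
    (∀ x ∈ Icc (-(d / (2 * lam))) (d / (2 * lam)),
        -(d / 2) * Real.sqrt (lam ^ 2 - 1) ≤ h x ∧
        h x ≤ -lam ^ 2 * Real.log (Real.cos (d / (2 * lam)))) ∧
    h 0 = -(d / 2) * Real.sqrt (lam ^ 2 - 1) ∧
    h (d / (2 * lam)) = -lam ^ 2 * Real.log (Real.cos (d / (2 * lam))) ∧
    h (-(d / (2 * lam))) = -lam ^ 2 * Real.log (Real.cos (d / (2 * lam))) := by
  intro h
  have hlam0 : 0 < lam := by linarith
  set a := d / (2 * lam) with ha
  have ha0 : 0 < a := by positivity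
  have hla : lam * a = d / 2 := by rw [ha]; field_simp
  have haπ : a < π / 2 := by
    rw [ha, div_lt_iff₀ (by positivity)]
    linarith
  have hcosa : 0 < Real.cos a := Real.cos_pos_of_mem_Ioo ⟨by linarith, haπ⟩
  refine ⟨fun x hx => ?_, ?_, ?_, ?_⟩
  · have hxa : |x| ≤ a := abs_le.mpr hx
    have hcos : Real.cos a ≤ Real.cos x := by
      rw [← Real.cos_abs x]
      exact Real.cos_le_cos_of_nonneg_of_le_pi (abs_nonneg x) (by linarith [Real.pi_pos]) hxa
    have hlog : Real.log (Real.cos a) ≤ Real.log (Real.cos x) := Real.log_le_log hcosa hcos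
    have hlog0 : Real.log (Real.cos x) ≤ 0 :=
      Real.log_nonpos (hcosa.le.trans hcos) (Real.cos_le_one x)
    have hsqrt : √((d / 2) ^ 2 - (lam * x) ^ 2) ≤ d / 2 :=
      (Real.sqrt_le_left (by positivity : 0 ≤ d / 2)).mpr (by linarith [sq_nonneg (lam * x)])
    have hmul := mul_le_mul_of_nonneg_left hsqrt (Real.sqrt_nonneg (lam ^ 2 - 1))
    have hmul0 : 0 ≤ √(lam ^ 2 - 1) * √((d / 2) ^ 2 - (lam * x) ^ 2) := by positivity
    have hlogmul := mul_le_mul_of_nonneg_left hlog (sq_nonneg lam)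
    have hlogmul0 := mul_nonpos_of_nonneg_of_nonpos (sq_nonneg lam) hlog0
    constructor <;> simp only [h] <;> linarith
  · have hd2 : √((d / 2) ^ 2) = d / 2 := Real.sqrt_sq (by positivity)
    simp only [h, Real.cos_zero, Real.log_one, mul_zero, ne_eq, OfNat.ofNat_ne_zero,
      not_false_eq_true, zero_pow, sub_zero, hd2]
    ring
  · simp [h, hla]
  · simp [h, hla]
end

section
/- Let d ≥ π. Then for every s > 1, the derivative of C at s satisfies C'(s) > (d²/(2π))·(1 − tan(π/(2s))). -/
open Real Set

lemma hasDerivAt_neg_sq_mul_log_cos_add_sqrt {d s : ℝ} (hs : s ≠ 0)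
    (hcos : cos (π / (2 * s)) ≠ 0) (hsq : (d * s / π) ^ 2 - 1 ≠ 0) :
    HasDerivAt (fun s : ℝ =>
      -(d * s / π) ^ 2 * Real.log (Real.cos (π / (2 * s)))
        + (d / 2) * Real.sqrt ((d * s / π) ^ 2 - 1))
      (-2 * (d ^ 2 / π ^ 2) * s * log (cos (π / (2 * s)))
        - d ^ 2 / (2 * π) * tan (π / (2 * s))
        + d ^ 3 / (2 * π ^ 2) * (s / √((d * s / π) ^ 2 - 1))) s := by
  have hlin : HasDerivAt (fun s : ℝ => d * s / π) (d / π) s := by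
    simpa using ((hasDerivAt_id s).const_mul d).div_const π
  have hangle : HasDerivAt (fun s : ℝ => π / (2 * s)) (-(π * 2) / (2 * s) ^ 2) s := by
    have h2 : HasDerivAt (fun s : ℝ => 2 * s) 2 s := by
      simpa using (hasDerivAt_id s).const_mul (2 : ℝ)
    simpa using (hasDerivAt_const s π).fun_div h2 (by positivity)
  have hlog := hangle.cos.log hcos
  have hsqrt := ((hlin.fun_pow 2).sub_const 1).sqrt hsq
  refine (((hlin.fun_pow 2).fun_neg.fun_mul hlog).fun_add
    (hsqrt.const_mul (d / 2))).congr_deriv ?_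
  have hpi := pi_ne_zero
  rw [tan_eq_sin_div_cos]
  generalize √((d * s / π) ^ 2 - 1) = r
  generalize π / (2 * s) = a at hcos ⊢
  simp only [Nat.cast_ofNat, Nat.add_one_sub_one, pow_one]
  field_simp
  ring

/-- For d ≥ π and s > 1, one has C' (s) > (d²/(2π)) (1 − tan (π/(2s))). -/
theorem C_deriv_lower_bound (d : ℝ) (hd : π ≤ d) :
    let C : ℝ → ℝ := fun s =>
      -(d * s / π) ^ 2 * Real.log (Real.cos (π / (2 * s)))
        + (d / 2) * Real.sqrt ((d * s / π) ^ 2 - 1)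
    ∀ s : ℝ, 1 < s →
      (d ^ 2 / (2 * π)) * (1 - Real.tan (π / (2 * s))) < deriv C s := by
  intro C s hs
  have hpi := pi_pos
  have hd0 : 0 < d := hpi.trans_le hd
  have hs0 : 0 < s := one_pos.trans hs
  have hangle_pos : 0 < π / (2 * s) := by positivity
  have hangle_lt : π / (2 * s) < π / 2 := by
    gcongr
    linarith
  have hcos : 0 < cos (π / (2 * s)) := cos_pos_of_mem_Ioo ⟨by linarith, hangle_lt⟩
  have hcos_lt : cos (π / (2 * s)) < 1 := by
    simpa using cos_lt_cos_of_nonneg_of_le_pi_div_two le_rfl hangle_lt.le hangle_pos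
  have hlog : log (cos (π / (2 * s))) < 0 := log_neg hcos hcos_lt
  have hx : 1 < d * s / π := by
    rw [one_lt_div hpi]
    nlinarith
  have hsq : 0 < (d * s / π) ^ 2 - 1 := by nlinarith
  have hr : 0 < √((d * s / π) ^ 2 - 1) := sqrt_pos.2 hsq
  have hr_lt : √((d * s / π) ^ 2 - 1) < d * s / π := by
    rw [sqrt_lt' (by positivity)]
    linarith
  rw [(hasDerivAt_neg_sq_mul_log_cos_add_sqrt hs0.ne' hcos.ne' hsq.ne').deriv]
  have hlog_term : 0 < -2 * (d ^ 2 / π ^ 2) * s * log (cos (π / (2 * s))) := by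
    have : 0 < 2 * (d ^ 2 / π ^ 2) * s := by positivity
    nlinarith
  have hsqrt_term : d ^ 2 / (2 * π) < d ^ 3 / (2 * π ^ 2) * (s / √((d * s / π) ^ 2 - 1)) := by
    have h : π / d < s / √((d * s / π) ^ 2 - 1) := by
      rw [lt_div_iff₀ hr]
      calc π / d * √((d * s / π) ^ 2 - 1) < π / d * (d * s / π) := by gcongr
        _ = s := by field_simp
    calc d ^ 2 / (2 * π) = d ^ 3 / (2 * π ^ 2) * (π / d) := by field_simp
      _ < _ := by gcongr
  linarith
end

section
/- Let d ≥ π. Then C is strictly monotone increasing on [2, +∞): for all s, t with 2 ≤ s < t one has C(s) < C(t). -/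
open Real Set

/-- On `[0, π / 4]` the function `-log ∘ cos` is `1`-Lipschitz. -/
lemma log_cos_sub_log_cos_le {x y : ℝ} (hx : 0 ≤ x) (hxy : x ≤ y) (hy : y ≤ π / 4) :
    log (cos x) - log (cos y) ≤ y - x := by
  have hπ := pi_pos
  have hcx : 0 < cos x := cos_pos_of_mem_Ioo ⟨by linarith, by linarith⟩
  have hcy : 0 < cos y := cos_pos_of_mem_Ioo ⟨by linarith, by linarith⟩
  have hsy : 0 ≤ sin y := sin_nonneg_of_nonneg_of_le_pi (by linarith) (by linarith)
  have hsc : sin y ≤ cos y := by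
    rw [← sin_pi_div_two_sub]
    exact sin_le_sin_of_le_of_le_pi_div_two (by linarith) (by linarith) (by linarith)
  have hcos : cos x = cos y * cos (y - x) + sin y * sin (y - x) := by
    rw [← cos_sub, sub_sub_cancel]
  have hle : cos x ≤ cos y * (1 + (y - x)) := by
    have h1 : cos y * cos (y - x) ≤ cos y * 1 :=
      mul_le_mul_of_nonneg_left (cos_le_one _) hcy.le
    have h2 : sin y * sin (y - x) ≤ cos y * (y - x) :=
      (mul_le_mul_of_nonneg_left (sin_le (sub_nonneg.2 hxy)) hsy).trans
        (mul_le_mul_of_nonneg_right hsc (sub_nonneg.2 hxy))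
    linarith
  have hpos : 0 < 1 + (y - x) := by linarith
  have hlog := log_le_log hcx hle
  rw [log_mul hcy.ne' hpos.ne'] at hlog
  linarith [log_le_sub_one_of_pos hpos]

/-- The function `u ↦ √(u ^ 2 - 1)` has slope at least `1` on `[1, ∞)`. -/
lemma sub_le_sqrt_sq_sub_one_sub {u v : ℝ} (hu : 1 ≤ u) (huv : u ≤ v) :
    v - u ≤ √(v ^ 2 - 1) - √(u ^ 2 - 1) := by
  have hw : √(u ^ 2 - 1) ^ 2 = u ^ 2 - 1 := sq_sqrt (by nlinarith)
  have hwu : √(u ^ 2 - 1) ≤ u := sqrt_le_iff.2 ⟨by linarith, by linarith⟩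
  have : √(u ^ 2 - 1) + (v - u) ≤ √(v ^ 2 - 1) := by
    apply le_sqrt_of_sq_le
    nlinarith [mul_le_mul_of_nonneg_right hwu (sub_nonneg.2 huv)]
  linarith

/-- For d ≥ π, C is strictly monotone increasing on [2, ∞). -/
theorem C_strictMono_on_Ici_two (d : ℝ) (hd : π ≤ d) :
    let C : ℝ → ℝ := fun s =>
      -(d * s / π) ^ 2 * Real.log (Real.cos (π / (2 * s)))
        + (d / 2) * Real.sqrt ((d * s / π) ^ 2 - 1)
    ∀ s t : ℝ, 2 ≤ s → s < t → C s < C t := by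
  intro C s t hs hst
  have hπ := pi_pos
  have hd0 : 0 < d := hπ.trans_le hd
  have hs0 : 0 < s := by linarith
  have ht0 : 0 < t := by linarith
  have hx : π / (2 * s) ≤ π / 4 := div_le_div_of_nonneg_left hπ.le (by norm_num) (by linarith)
  have hy : 0 < π / (2 * t) := by positivity
  have hyx : π / (2 * t) ≤ π / (2 * s) :=
    div_le_div_of_nonneg_left hπ.le (by positivity) (by linarith)
  have hlog := log_cos_sub_log_cos_le hy.le hyx hx
  have hneg : log (cos (π / (2 * t))) < 0 := by
    apply log_neg (cos_pos_of_mem_Ioo ⟨by linarith, by linarith⟩)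
    rw [← cos_zero]
    exact cos_lt_cos_of_nonneg_of_le_pi le_rfl (by linarith) hy
  have hu : 1 ≤ d * s / π := by
    rw [le_div_iff₀ hπ]
    nlinarith
  have huv : d * s / π < d * t / π := by gcongr
  have hsqrt := sub_le_sqrt_sq_sub_one_sub hu huv.le
  have hxu : π / (2 * s) = d / 2 / (d * s / π) := by field_simp
  have hyv : π / (2 * t) = d / 2 / (d * t / π) := by field_simp
  change -(d * s / π) ^ 2 * log (cos (π / (2 * s))) + d / 2 * √((d * s / π) ^ 2 - 1)
    < -(d * t / π) ^ 2 * log (cos (π / (2 * t))) + d / 2 * √((d * t / π) ^ 2 - 1)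
  generalize log (cos (π / (2 * s))) = a at *
  generalize log (cos (π / (2 * t))) = b at *
  rw [hxu, hyv] at hlog
  generalize d * s / π = u at *
  generalize d * t / π = v at *
  have hu0 : 0 < u := by linarith
  have hv0 : 0 < v := by linarith
  have hgap : u ^ 2 * (d / 2 / u - d / 2 / v) ≤ d / 2 * (v - u) := by
    have : u ^ 2 * (d / 2 / u - d / 2 / v) = d / 2 * (v - u) * (u / v) := by
      field_simp
    rw [this]
    exact mul_le_of_le_one_right (mul_nonneg (by positivity) (by linarith))
      ((div_le_one hv0).2 huv.le)
  have h1 := mul_le_mul_of_nonneg_left hlog (sq_nonneg u)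
  have h2 := mul_le_mul_of_nonneg_left hsqrt (by positivity : 0 ≤ d / 2)
  have h3 : 0 < (v ^ 2 - u ^ 2) * -b :=
    mul_pos (by nlinarith) (by linarith)
  linarith
end

section
/- Let d ≥ π. Then the global minimum of C on (1, +∞) is attained in (1, 2]: there exists s* with 1 < s* ≤ 2 such that C(s*) ≤ C(s) for all s > 1. -/
open Real Set

lemma cos_pi_div_two_mul_pos {s : ℝ} (hs : 1 < s) : 0 < Real.cos (π / (2 * s)) := by
  have hs0 : 0 < s := by linarith
  apply Real.cos_pos_of_mem_Ioo
  constructor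
  · have : 0 < π / (2 * s) := by positivity
    linarith [Real.pi_pos]
  · rw [div_lt_div_iff₀ (by positivity) (by norm_num)]
    nlinarith [Real.pi_pos]

lemma hasDerivAt_neg_sq_mul_log_cos {s : ℝ} (hs : 1 < s) :
    HasDerivAt (fun s : ℝ => -s ^ 2 * Real.log (Real.cos (π / (2 * s))) + π / 2 * s)
      (-(2 * s) * Real.log (Real.cos (π / (2 * s)))
        + π / 2 * (1 - Real.tan (π / (2 * s)))) s := by
  have hs0 : s ≠ 0 := by linarith
  have hcos := (cos_pi_div_two_mul_pos hs).ne'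
  have hθ : HasDerivAt (fun s : ℝ => π / (2 * s)) (-(π / (2 * s ^ 2))) s := by
    refine (((hasDerivAt_id s).const_mul 2).fun_inv (by simpa using hs0)
      |>.const_mul π).congr_deriv ?_
    simp only [id]
    field_simp
  refine ((((hasDerivAt_id s).fun_pow 2).fun_neg.fun_mul (hθ.cos.log hcos)).fun_add
    ((hasDerivAt_id s).const_mul (π / 2))).congr_deriv ?_
  rw [Real.tan_eq_sin_div_cos]
  simp only [id]
  field_simp
  ring

lemma monotoneOn_neg_sq_mul_log_cos :
    MonotoneOn (fun s : ℝ => -s ^ 2 * Real.log (Real.cos (π / (2 * s))) + π / 2 * s) (Ici 2) := by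
  have hderiv : ∀ s ∈ Ici (2 : ℝ), _ := fun s hs =>
    hasDerivAt_neg_sq_mul_log_cos (s := s) (by linarith [mem_Ici.1 hs])
  refine monotoneOn_of_hasDerivWithinAt_nonneg (convex_Ici 2)
    (fun s hs => (hderiv s hs).continuousAt.continuousWithinAt)
    (fun s hs => (hderiv s (interior_subset hs)).hasDerivWithinAt) fun s hs => ?_
  have h2 : 2 ≤ s := interior_subset hs
  have hcos := cos_pi_div_two_mul_pos (show 1 < s by linarith)
  have hlog : Real.log (Real.cos (π / (2 * s))) ≤ 0 :=
    Real.log_nonpos hcos.le (Real.cos_le_one _)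
  have hle : π / (2 * s) ≤ π / 4 := by
    gcongr
    linarith
  have hpos : 0 < π / (2 * s) := by positivity
  have htan : Real.tan (π / (2 * s)) ≤ 1 := by
    rw [← Real.tan_pi_div_four]
    exact Real.strictMonoOn_tan.monotoneOn
      ⟨by linarith [Real.pi_pos], by linarith [Real.pi_pos]⟩
      ⟨by linarith [Real.pi_pos], by linarith [Real.pi_pos]⟩ hle
  have h3 : 0 ≤ π / 2 * (1 - Real.tan (π / (2 * s))) :=
    mul_nonneg (by positivity) (by linarith)
  nlinarith

lemma sub_le_sqrt_sq_sub_one_sub_s12 {x y : ℝ} (hx : 1 < x) (hxy : x ≤ y) :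
    y - x ≤ Real.sqrt (y ^ 2 - 1) - Real.sqrt (x ^ 2 - 1) := by
  have h1 := Real.sq_sqrt (show 0 ≤ x ^ 2 - 1 by nlinarith)
  have h2 : Real.sqrt (x ^ 2 - 1) ≤ x := Real.sqrt_le_iff.2 ⟨by linarith, by linarith⟩
  have h3 : y - x + Real.sqrt (x ^ 2 - 1) ≤ Real.sqrt (y ^ 2 - 1) :=
    Real.le_sqrt_of_sq_le (by nlinarith)
  linarith

/-- For d ≥ π, the global minimum of C on (1, ∞) is attained in (1, 2]. -/
theorem C_min_in_Ioc_one_two (d : ℝ) (hd : π ≤ d) :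
    let C : ℝ → ℝ := fun s =>
      -(d * s / π) ^ 2 * Real.log (Real.cos (π / (2 * s)))
        + (d / 2) * Real.sqrt ((d * s / π) ^ 2 - 1)
    ∃ sstar : ℝ, 1 < sstar ∧ sstar ≤ 2 ∧ ∀ s : ℝ, 1 < s → C sstar ≤ C s := by
  intro C
  have hπ := Real.pi_pos
  have hd0 : 0 < d := by linarith
  have ha : 1 ≤ d / π := (one_le_div hπ).2 hd
  have hright : ∀ s, 2 ≤ s → C 2 ≤ C s := by
    intro s hs
    have hmono := monotoneOn_neg_sq_mul_log_cos (mem_Ici.2 le_rfl) (mem_Ici.2 hs) hs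
    have hsqrt := sub_le_sqrt_sq_sub_one_sub_s12 (x := d / π * 2) (y := d / π * s)
      (by linarith) (by gcongr)
    have h1 := mul_le_mul_of_nonneg_left hmono (sq_nonneg (d / π))
    have h2 := mul_le_mul_of_nonneg_left hsqrt (show 0 ≤ d / 2 by positivity)
    have h3 : d / 2 * (d / π * s - d / π * 2) = (d / π) ^ 2 * (π / 2 * s - π / 2 * 2) := by
      field_simp
    simp only [C, mul_div_right_comm d _ π]
    linarith
  have hcontθ : ContinuousAt (fun s : ℝ => Real.cos (π / (2 * s))) 1 := by
    fun_prop (disch := norm_num)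
  have hev := hcontθ.eventually_lt (continuousAt_const (y := Real.exp (-C 2)))
    (by simpa using Real.exp_pos (-C 2))
  obtain ⟨ε, hε, hball⟩ := Metric.eventually_nhds_iff.1 hev
  have hleft : ∀ s, 1 < s → s < 1 + ε → C 2 ≤ C s := by
    intro s hs hsε
    have hcos := cos_pi_div_two_mul_pos hs
    have hlt := hball (y := s) (by rw [Real.dist_eq, abs_lt]; constructor <;> linarith)
    have hlog : Real.log (Real.cos (π / (2 * s))) ≤ 0 :=
      Real.log_nonpos hcos.le (Real.cos_le_one _)
    have hlog' := (Real.log_lt_iff_lt_exp hcos).2 hlt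
    have hx : 1 ≤ d * s / π := by
      rw [mul_div_right_comm]
      nlinarith
    have hsq : 1 ≤ (d * s / π) ^ 2 := one_le_pow₀ hx
    have hnonneg : 0 ≤ d / 2 * Real.sqrt ((d * s / π) ^ 2 - 1) := by positivity
    have hCs : C s = -(d * s / π) ^ 2 * Real.log (Real.cos (π / (2 * s)))
        + (d / 2) * Real.sqrt ((d * s / π) ^ 2 - 1) := rfl
    nlinarith
  set m := min (1 + ε) 2
  have hm1 : 1 < m := lt_min (by linarith) (by norm_num)
  have hm2 : m ≤ 2 := min_le_right _ _
  have hcont : ContinuousOn C (Icc m 2) := by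
    intro s hs
    have hs1 : 1 < s := hm1.trans_le hs.1
    have hcos := (cos_pi_div_two_mul_pos hs1).ne'
    have hs0 : 2 * s ≠ 0 := by linarith
    apply ContinuousAt.continuousWithinAt
    simp only [C]
    fun_prop (disch := assumption)
  obtain ⟨t, ht, hmin⟩ := isCompact_Icc.exists_isMinOn (nonempty_Icc.2 hm2) hcont
  have ht2 : C t ≤ C 2 := hmin (right_mem_Icc.2 hm2)
  refine ⟨t, hm1.trans_le ht.1, ht.2, fun s hs => ?_⟩
  rcases le_total 2 s with h2 | h2
  · exact ht2.trans (hright s h2)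
  rcases lt_or_ge s (1 + ε) with h1 | h1
  · exact ht2.trans (hleft s hs h1)
  · exact hmin ⟨(min_le_left _ _).trans h1, h2⟩
end

section
/- Let d ≥ π. Then for every s > 1, the derivative of C at s satisfies C'(s) > (d²/(2π))·(2 − cos(π/(2s)) − tan(π/(2s))). -/
open Real Set

/-- For d ≥ π and s > 1, C' (s) > (d²/(2π)) (2 − cos (π/(2s)) − tan (π/(2s))). -/
theorem C_deriv_improved_lower_bound (d : ℝ) (hd : π ≤ d) :
    let C : ℝ → ℝ := fun s =>
      -(d * s / π) ^ 2 * Real.log (Real.cos (π / (2 * s)))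
        + (d / 2) * Real.sqrt ((d * s / π) ^ 2 - 1)
    ∀ s : ℝ, 1 < s →
      (d ^ 2 / (2 * π)) * (2 - Real.cos (π / (2 * s)) - Real.tan (π / (2 * s)))
        < deriv C s := by
  intro C s hs
  have hπ := Real.pi_pos
  have hs0 : 0 < s := by linarith
  have hd0 : 0 < d := by linarith
  have hA1 : 1 < d * s / π := by
    rw [lt_div_iff₀ hπ]; nlinarith
  have hx0 : 0 < π / (2 * s) := by positivity
  have hx2 : π / (2 * s) < π / 2 := by
    apply div_lt_div_of_pos_left hπ <;> linarith
  have hcos : 0 < cos (π / (2 * s)) := cos_pos_of_mem_Ioo ⟨by linarith, hx2⟩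
  have hrad : 0 < (d * s / π) ^ 2 - 1 := by nlinarith
  have hA : HasDerivAt (fun t : ℝ => d * t / π) (d / π) s := by
    simpa using ((hasDerivAt_id s).const_mul d).div_const π
  have hx : HasDerivAt (fun t : ℝ => π / (2 * t)) (-(π / (2 * s ^ 2))) s := by
    have h := (hasDerivAt_const s π).fun_div ((hasDerivAt_id s).const_mul 2)
      (by simpa using hs0.ne')
    refine h.congr_deriv ?_
    simp only [id]
    field_simp
    ring
  have hderiv := ((hA.fun_pow 2).fun_neg.fun_mul (hx.cos.log hcos.ne')).fun_add
    (((hA.fun_pow 2).sub_const 1).sqrt hrad.ne' |>.const_mul (d / 2))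
  have hC : HasDerivAt C
      (d ^ 2 / (2 * π) * (4 * s / π * -log (cos (π / (2 * s))) - tan (π / (2 * s))
        + d * s / π / √((d * s / π) ^ 2 - 1))) s := by
    refine hderiv.congr_deriv ?_
    have hsq : √((d * s / π) ^ 2 - 1) ≠ 0 := (sqrt_pos.2 hrad).ne'
    rw [tan_eq_sin_div_cos]
    generalize √((d * s / π) ^ 2 - 1) = r at *
    generalize log (cos (π / (2 * s))) = l at *
    generalize cos (π / (2 * s)) = c at *
    generalize sin (π / (2 * s)) = e at *
    norm_num only [pow_one]
    field_simp
    ring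
  rw [hC.deriv]
  have hlog : 1 - cos (π / (2 * s)) ≤ -log (cos (π / (2 * s))) := by
    linarith [log_le_sub_one_of_pos hcos]
  have hcoef : 1 ≤ 4 * s / π := by
    rw [le_div_iff₀ hπ]; linarith [pi_le_four]
  have hcos1 := cos_le_one (π / (2 * s))
  have hsqrt : 1 < d * s / π / √((d * s / π) ^ 2 - 1) := by
    rw [lt_div_iff₀ (sqrt_pos.2 hrad), one_mul, sqrt_lt' (by linarith)]
    linarith
  refine mul_lt_mul_of_pos_left ?_ (by positivity)
  nlinarith
end

section
/- Let s₀ = π/(2·arctan((4 − √2)/2)). Then for every real s with s₀ ≤ s ≤ 2 one has cos(π/(2s)) + tan(π/(2s)) ≤ 2. -/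
open Real Set

/-- For s₀ = π/(2 arctan ((4 − √2)/2)) and s₀ ≤ s ≤ 2:
cos (π/(2s)) + tan (π/(2s)) ≤ 2. -/
theorem cos_add_tan_le_two :
    let s₀ : ℝ := π / (2 * Real.arctan ((4 - Real.sqrt 2) / 2))
    ∀ s : ℝ, s₀ ≤ s → s ≤ 2 →
      Real.cos (π / (2 * s)) + Real.tan (π / (2 * s)) ≤ 2 := by
  intro s₀ s hs₀ hs
  have hsqrt : √2 < 4 := by
    rw [Real.sqrt_lt' (by norm_num)]
    norm_num
  have harctan : 0 < arctan ((4 - √2) / 2) := Real.arctan_pos.2 (by linarith)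
  have hs_pos : 0 < s := lt_of_lt_of_le (by positivity) hs₀
  have hlower : π / 4 ≤ π / (2 * s) := by
    gcongr
    linarith
  have hupper : π / (2 * s) ≤ arctan ((4 - √2) / 2) := by
    have h := (div_le_iff₀ (by positivity)).1 hs₀
    rw [div_le_iff₀ (by positivity)]
    linarith
  have hlt : arctan ((4 - √2) / 2) < π / 2 := Real.arctan_lt_pi_div_two _
  have hcos : cos (π / (2 * s)) ≤ √2 / 2 := by
    rw [← Real.cos_pi_div_four]
    exact Real.cos_le_cos_of_nonneg_of_le_pi (by positivity) (by linarith [pi_pos]) hlower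
  have htan : tan (π / (2 * s)) ≤ (4 - √2) / 2 := by
    rw [← Real.tan_arctan ((4 - √2) / 2)]
    exact Real.strictMonoOn_tan.monotoneOn
      ⟨by linarith [pi_pos], by linarith⟩ ⟨by linarith [pi_pos], hlt⟩ hupper
  linarith
end

section
/- Let d ≥ π and let s₀ = π/(2·arctan((4 − √2)/2)). Then C is strictly monotone increasing on [s₀, +∞): for all s, t with s₀ ≤ s < t one has C(s) < C(t). -/
open Real Set

/-- `x (tan x - 1) ≤ -2 log (cos x)` for `0 < x ≤ arctan ((4 - √2) / 2)`. -/
theorem mul_tan_sub_one_le_neg_two_mul_log_cos {x : ℝ} (hx0 : 0 < x)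
    (hx : x ≤ arctan ((4 - √2) / 2)) :
    x * (tan x - 1) ≤ -2 * log (cos x) := by
  have hx2 : x < π / 2 := hx.trans_lt (arctan_lt_pi_div_two _)
  have hcos : 0 < cos x := cos_pos_of_mem_Ioo ⟨by linarith, hx2⟩
  have hlog : log (cos x) ≤ cos x - 1 := log_le_sub_one_of_pos hcos
  have hquad : cos x ≤ 1 - 2 / π ^ 2 * x ^ 2 :=
    cos_le_one_sub_mul_cos_sq (by rw [abs_of_pos hx0]; linarith)
  have harctan : arctan (tan x) = x := arctan_tan (by linarith) hx2
  have hpi : 4 / π ^ 2 * (π / 4) = 1 / π := by field_simp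
  have hpi_inv : (0.3 : ℝ) ≤ 1 / π := by
    rw [le_div_iff₀ pi_pos]
    linarith [pi_lt_d2]
  have hmain : tan x - 1 ≤ 4 / π ^ 2 * x := by
    rcases le_or_gt (tan x) 1 with h | h
    · have : 0 ≤ 4 / π ^ 2 * x := by positivity
      linarith
    · have hlt : π / 4 < x := by
        rw [← harctan, ← arctan_one]
        exact arctan_strictMono h
      have htan : tan x ≤ (4 - √2) / 2 := by
        rw [← harctan] at hx
        exact arctan_strictMono.le_iff_le.mp hx
      have hsqrt : (1.41 : ℝ) ≤ √2 := le_sqrt_of_sq_le (by norm_num)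
      have : 4 / π ^ 2 * (π / 4) ≤ 4 / π ^ 2 * x := by gcongr
      linarith
  calc x * (tan x - 1) ≤ x * (4 / π ^ 2 * x) := by gcongr
    _ = 2 * (2 / π ^ 2 * x ^ 2) := by ring
    _ ≤ -2 * log (cos x) := by linarith

/-- For d ≥ π, C is strictly monotone increasing on [s₀, ∞),
where s₀ = π/(2 arctan ((4 − √2)/2)). -/
theorem C_strictMono_on_Ici_s_zero (d : ℝ) (hd : π ≤ d) :
    let C : ℝ → ℝ := fun s =>
      -(d * s / π) ^ 2 * Real.log (Real.cos (π / (2 * s)))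
        + (d / 2) * Real.sqrt ((d * s / π) ^ 2 - 1)
    let s₀ : ℝ := π / (2 * Real.arctan ((4 - Real.sqrt 2) / 2))
    ∀ s t : ℝ, s₀ ≤ s → s < t → C s < C t := by
  intro C s₀ s t hs hst
  have hpi := pi_pos
  have hd0 : 0 < d := hpi.trans_le hd
  have harctan : 0 < arctan ((4 - √2) / 2) := by
    rw [arctan_pos]
    have : √2 ≤ 2 := sqrt_le_iff.mpr (by norm_num)
    linarith
  have hs₀ : 1 < s₀ := by
    rw [lt_div_iff₀ (by positivity)]
    linarith [arctan_lt_pi_div_two ((4 - √2) / 2)]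
  have hderiv : ∀ r ∈ Ici s₀, ∃ C', HasDerivAt C C' r ∧ 0 < C' := by
    intro r hr
    have hr1 : 1 < r := hs₀.trans_le hr
    have hr0 : 0 < r := by linarith
    set x := π / (2 * r) with hx
    have hx0 : 0 < x := by positivity
    have hxle : x ≤ arctan ((4 - √2) / 2) := by
      have h : π / (2 * arctan ((4 - √2) / 2)) ≤ r := hr
      rw [div_le_iff₀ (by positivity)] at h
      rw [hx, div_le_iff₀ (by positivity)]
      linarith
    have hcos : 0 < cos x :=
      cos_pos_of_mem_Ioo ⟨by linarith, hxle.trans_lt (arctan_lt_pi_div_two _)⟩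
    have hu : 1 < d * r / π := by
      rw [lt_div_iff₀ hpi]
      nlinarith
    set u := d * r / π with hu_def
    have hu2 : 0 < u ^ 2 - 1 := by nlinarith
    have hsqrt : 0 < √(u ^ 2 - 1) := sqrt_pos.mpr hu2
    have hlin : HasDerivAt (fun y : ℝ => d * y / π) (d / π) r := by
      simpa using ((hasDerivAt_id r).const_mul d).div_const π
    have hangle : HasDerivAt (fun y : ℝ => π / (2 * y)) (-(π / (2 * r ^ 2))) r := by
      have h := (hasDerivAt_const r π).div ((hasDerivAt_id r).const_mul 2) (by simp; positivity)
      refine h.congr_deriv ?_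
      simp only [id]
      field_simp
      ring
    have hC := ((hlin.pow 2).neg.mul (hangle.cos.log hcos.ne')).add
      ((((hlin.pow 2).sub_const 1).sqrt hu2.ne').const_mul (d / 2))
    refine ⟨_, hC, ?_⟩
    have hratio : 1 < u / √(u ^ 2 - 1) := by
      rw [one_lt_div hsqrt]
      exact (sqrt_lt' (by linarith)).mpr (by linarith)
    have hkey := mul_tan_sub_one_le_neg_two_mul_log_cos hx0 hxle
    have hbound : 0 ≤ -2 * log (cos x) / x - (tan x - 1) := by
      rw [sub_nonneg, le_div_iff₀ hx0]
      linarith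
    have hpos : 0 < d ^ 2 / (2 * π) *
        (-2 * log (cos x) / x - (tan x - 1) + (u / √(u ^ 2 - 1) - 1)) := by
      apply mul_pos (by positivity)
      linarith
    convert hpos using 1
    rw [tan_eq_sin_div_cos]
    simp only [Pi.pow_apply, Pi.neg_apply, Nat.cast_ofNat, Nat.add_one_sub_one, pow_one, ← hx, ← hu_def]
    generalize √(u ^ 2 - 1) = w at *
    rw [hu_def]
    generalize hL : log (cos x) = L
    have hr' : r = π / (2 * x) := by rw [hx]; field_simp
    generalize cos x = c at *
    generalize sin x = z at *
    clear_value x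
    subst hr'
    field_simp
    ring
  have hmono : StrictMonoOn C (Ici s₀) := by
    apply strictMonoOn_of_deriv_pos (convex_Ici s₀)
    · intro r hr
      obtain ⟨C', hC', -⟩ := hderiv r hr
      exact hC'.continuousAt.continuousWithinAt
    · intro r hr
      obtain ⟨C', hC', hpos⟩ := hderiv r (interior_subset hr)
      rwa [hC'.deriv]
  exact hmono hs (mem_Ici.mpr (le_trans hs hst.le)) hst
end
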